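/- Let N ≥ 3, α ∈ [0,2), β > 0 and b, c ∈ ℝ. Set b₁ = 2α − b and c₁ = c + (b − α)(α − 2 + N). Then for all u, v ∈ C_c^∞(ℝ^N \ {0}; ℂ) one has the formal adjoint identity ∫_{ℝ^N} (A_{b,c}u) \bar{v} dx = ∫_{ℝ^N} u \overline{(A_{b₁,c₁} v)} dx. -/

import Mathlib

open MeasureTheory Real

noncomputable section

/-- The `i`-th partial derivative of a complex-valued function on `ℝ^N`. -/
def pdC {N : ℕ} (i : Fin N) (f : EuclideanSpace ℝ (Fin N) → ℂ)
    (x : EuclideanSpace ℝ (Fin N)) : ℂ :=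
  fderiv ℝ f x (EuclideanSpace.single i 1)

/-- The Laplacian of a complex-valued function on `ℝ^N`. -/
def lapC {N : ℕ} (f : EuclideanSpace ℝ (Fin N) → ℂ)
    (x : EuclideanSpace ℝ (Fin N)) : ℂ :=
  ∑ i, pdC i (pdC i f) x

/-- The elliptic operator `A_{b,c} = (1+|x|^α)Δ + b|x|^{α-2} x·∇ - c|x|^{α-2} - |x|^β`. -/
def Abc {N : ℕ} (α β b c : ℝ) (f : EuclideanSpace ℝ (Fin N) → ℂ)
    (x : EuclideanSpace ℝ (Fin N)) : ℂ :=
  ((1 + ‖x‖ ^ α : ℝ) : ℂ) * lapC f x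
    + ((b * ‖x‖ ^ (α - 2) : ℝ) : ℂ) * ∑ i, (x i : ℂ) * pdC i f x
    - ((c * ‖x‖ ^ (α - 2) : ℝ) : ℂ) * f x
    - ((‖x‖ ^ β : ℝ) : ℂ) * f x

/-- The Yosida approximation `W_ε(x) = 1/(|x|^{2-α} + ε)` of the potential `|x|^{α-2}`. -/
def Weps {N : ℕ} (α ε : ℝ) (x : EuclideanSpace ℝ (Fin N)) : ℝ :=
  1 / (‖x‖ ^ (2 - α) + ε)

/-- Smooth compactly supported functions whose support avoids the origin. -/
def IsTestAway0 {N : ℕ} (u : EuclideanSpace ℝ (Fin N) → ℂ) : Prop :=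
  ContDiff ℝ (⊤ : ℕ∞) u ∧ HasCompactSupport u ∧ (0 : EuclideanSpace ℝ (Fin N)) ∉ tsupport u

section PartialDerivatives

variable {N : ℕ} {f g : EuclideanSpace ℝ (Fin N) → ℂ} {x : EuclideanSpace ℝ (Fin N)}

lemma pdC_mul (i : Fin N) (hf : DifferentiableAt ℝ f x) (hg : DifferentiableAt ℝ g x) :
    pdC i (fun y => f y * g y) x = f x * pdC i g x + pdC i f x * g x := by
  unfold pdC
  rw [fderiv_fun_mul hf hg]
  simp [mul_comm]

lemma pdC_add (i : Fin N) (hf : DifferentiableAt ℝ f x) (hg : DifferentiableAt ℝ g x) :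
    pdC i (fun y => f y + g y) x = pdC i f x + pdC i g x := by
  unfold pdC
  rw [fderiv_fun_add hf hg]
  simp

lemma pdC_sub (i : Fin N) (hf : DifferentiableAt ℝ f x) (hg : DifferentiableAt ℝ g x) :
    pdC i (fun y => f y - g y) x = pdC i f x - pdC i g x := by
  unfold pdC
  rw [fderiv_fun_sub hf hg]
  simp

lemma pdC_conj (i : Fin N) (f : EuclideanSpace ℝ (Fin N) → ℂ) :
    pdC i (fun y => (starRingEnd ℂ) (f y)) = fun y => (starRingEnd ℂ) (pdC i f y) := by
  ext y
  have h := Complex.conjCLE.comp_fderiv (f := f) (x := y)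
  unfold pdC
  change fderiv ℝ (Complex.conjCLE ∘ f) y _ = _
  rw [h]
  simp

lemma lapC_conj (f : EuclideanSpace ℝ (Fin N) → ℂ) (x : EuclideanSpace ℝ (Fin N)) :
    lapC (fun y => (starRingEnd ℂ) (f y)) x = (starRingEnd ℂ) (lapC f x) := by
  simp [lapC, pdC_conj]

lemma pdC_eventuallyEq_zero (i : Fin N) (hf : f =ᶠ[nhds x] 0) : pdC i f =ᶠ[nhds x] 0 := by
  filter_upwards [hf.fderiv (𝕜 := ℝ)] with y hy
  simp [pdC, hy]

lemma contDiff_pdC (i : Fin N) (hf : ContDiff ℝ (⊤ : ℕ∞) f) :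
    ContDiff ℝ (⊤ : ℕ∞) (pdC i f) := by
  unfold pdC
  exact (hf.fderiv_right (m := (⊤ : ℕ∞)) (by simp)).clm_apply contDiff_const

lemma pdC_coord (i : Fin N) (x : EuclideanSpace ℝ (Fin N)) :
    pdC i (fun y => ((y i : ℝ) : ℂ)) x = 1 := by
  have h : HasFDerivAt (fun y : EuclideanSpace ℝ (Fin N) => ((y i : ℝ) : ℂ))
      (Complex.ofRealCLM.comp (EuclideanSpace.proj i : EuclideanSpace ℝ (Fin N) →L[ℝ] ℝ)) x :=
    (Complex.ofRealCLM.comp (EuclideanSpace.proj i)).hasFDerivAt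
  simp [pdC, h.fderiv]

lemma contDiff_coord (i : Fin N) {n : WithTop ℕ∞} :
    ContDiff ℝ n (fun y : EuclideanSpace ℝ (Fin N) => ((y i : ℝ) : ℂ)) :=
  (Complex.ofRealCLM.comp (EuclideanSpace.proj i : EuclideanSpace ℝ (Fin N) →L[ℝ] ℝ)).contDiff

lemma contDiffAt_norm_rpow {n : WithTop ℕ∞} (p : ℝ) (hx : x ≠ 0) :
    ContDiffAt ℝ n (fun y : EuclideanSpace ℝ (Fin N) => ((‖y‖ ^ p : ℝ) : ℂ)) x :=
  Complex.ofRealCLM.contDiff.contDiffAt.comp x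
    ((contDiffAt_norm ℝ hx).rpow_const_of_ne (norm_ne_zero_iff.mpr hx))

lemma pdC_norm_rpow (i : Fin N) (p : ℝ) (hx : x ≠ 0) :
    pdC i (fun y => ((‖y‖ ^ p : ℝ) : ℂ)) x = ((p * ‖x‖ ^ (p - 2) * x i : ℝ) : ℂ) := by
  have hpow (q : ℝ) (y : EuclideanSpace ℝ (Fin N)) : (‖y‖ ^ 2) ^ (q / 2) = ‖y‖ ^ q := by
    rw [← Real.rpow_natCast, ← Real.rpow_mul (norm_nonneg y)]
    congr 1
    push_cast
    ring
  have h := ((hasStrictFDerivAt_norm_sq x).hasFDerivAt.rpow_const (p := p / 2)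
    (Or.inl (pow_ne_zero 2 (norm_ne_zero_iff.mpr hx))))
  rw [show p / 2 - 1 = (p - 2) / 2 by ring, hpow] at h
  simp only [hpow] at h
  have h' := Complex.ofRealCLM.hasFDerivAt.comp x h
  have e : pdC i (fun y => ((‖y‖ ^ p : ℝ) : ℂ)) x = _ :=
    congrArg (fun L => L (EuclideanSpace.single i 1)) h'.fderiv
  rw [e]
  simp [EuclideanSpace.inner_single_right]
  ring

lemma integrable_pdC (i : Fin N) (hf : ContDiff ℝ 1 f) (hc : HasCompactSupport f) :
    Integrable (pdC i f) :=
  ((hf.continuous_fderiv one_ne_zero).clm_apply continuous_const).integrable_of_hasCompactSupport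
    (hc.fderiv_apply ℝ _)

lemma integral_pdC_eq_zero (i : Fin N) (hf : ContDiff ℝ 1 f) (hc : HasCompactSupport f) :
    ∫ x, pdC i f x = 0 := by
  have hi : Integrable (fun x => fderiv ℝ f x (EuclideanSpace.single i 1)) :=
    integrable_pdC i hf hc
  have h := integral_mul_fderiv_eq_neg_fderiv_mul_of_integrable (μ := volume)
    (f := fun _ : EuclideanSpace ℝ (Fin N) => (1 : ℂ)) (g := f)
    (v := EuclideanSpace.single i 1) (by simp) (by simpa using hi)
    (by simpa using hf.continuous.integrable_of_hasCompactSupport hc)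
    (fun x _ => differentiableAt_const _) (fun x _ => hf.differentiable one_ne_zero x)
  simpa [pdC] using h

end PartialDerivatives

/-- The vector field whose divergence is `(A_{b,c} u) w - u (A_{b₁,c₁} w)`. -/
def adjointFlux {N : ℕ} (α b : ℝ) (u w : EuclideanSpace ℝ (Fin N) → ℂ) (i : Fin N)
    (x : EuclideanSpace ℝ (Fin N)) : ℂ :=
  (1 + ((‖x‖ ^ α : ℝ) : ℂ)) * (pdC i u x * w x - u x * pdC i w x)
    + ((b - α : ℝ) : ℂ) * (((‖x‖ ^ (α - 2) : ℝ) : ℂ) * ((x i : ℂ) * (u x * w x)))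

section Flux

variable {N : ℕ} {u w : EuclideanSpace ℝ (Fin N) → ℂ} {x : EuclideanSpace ℝ (Fin N)}

lemma adjointFlux_eventuallyEq_zero (α b : ℝ) (i : Fin N) (hx : x ∉ tsupport u) :
    adjointFlux α b u w i =ᶠ[nhds x] 0 := by
  have h := notMem_tsupport_iff_eventuallyEq.mp hx
  filter_upwards [h, pdC_eventuallyEq_zero i h] with y h0 h1
  simp [adjointFlux, h0, h1]

lemma contDiff_adjointFlux (α b : ℝ) (i : Fin N) (hu : ContDiff ℝ (⊤ : ℕ∞) u)
    (hw : ContDiff ℝ (⊤ : ℕ∞) w) (h0 : 0 ∉ tsupport u) :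
    ContDiff ℝ 1 (adjointFlux α b u w i) := by
  rw [contDiff_iff_contDiffAt]
  intro x
  by_cases hx : x ∈ tsupport u
  · have hx0 : x ≠ 0 := by
      rintro rfl
      exact h0 hx
    have hle : (1 : WithTop ℕ∞) ≤ ((⊤ : ℕ∞) : WithTop ℕ∞) := by exact_mod_cast le_top
    have h1 := (hu.of_le hle).contDiffAt (x := x)
    have h2 := (hw.of_le hle).contDiffAt (x := x)
    have h3 := ((contDiff_pdC i hu).of_le hle).contDiffAt (x := x)
    have h4 := ((contDiff_pdC i hw).of_le hle).contDiffAt (x := x)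
    exact ((contDiffAt_const.add (contDiffAt_norm_rpow α hx0)).mul
      ((h3.mul h2).sub (h1.mul h4))).add (contDiffAt_const.mul
      ((contDiffAt_norm_rpow (α - 2) hx0).mul ((contDiff_coord i).contDiffAt.mul (h1.mul h2))))
  · exact contDiffAt_const.congr_of_eventuallyEq (adjointFlux_eventuallyEq_zero α b i hx)

lemma hasCompactSupport_adjointFlux (α b : ℝ) (i : Fin N) (hu : HasCompactSupport u) :
    HasCompactSupport (adjointFlux α b u w i) :=
  HasCompactSupport.intro hu fun _ hx => (adjointFlux_eventuallyEq_zero α b i hx).eq_of_nhds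

lemma pdC_adjointFlux (α b : ℝ) (i : Fin N) (hu : ContDiff ℝ (⊤ : ℕ∞) u)
    (hw : ContDiff ℝ (⊤ : ℕ∞) w) (hx : x ≠ 0) :
    pdC i (adjointFlux α b u w i) x =
      (1 + ((‖x‖ ^ α : ℝ) : ℂ)) * (pdC i (pdC i u) x * w x - u x * pdC i (pdC i w) x)
      + α * ((‖x‖ ^ (α - 2) : ℝ) : ℂ) * (x i * pdC i u x * w x - u x * (x i * pdC i w x))
      + (b - α) * ((‖x‖ ^ (α - 2) : ℝ) : ℂ) *
        (u x * w x + x i * pdC i u x * w x + u x * (x i * pdC i w x))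
      + (b - α) * (α - 2) * ((‖x‖ ^ (α - 2 - 2) : ℝ) : ℂ) * (x i : ℂ) ^ 2 * (u x * w x) := by
  have hne : ((⊤ : ℕ∞) : WithTop ℕ∞) ≠ 0 := by simp
  have d1 := hu.differentiable hne x
  have d2 := hw.differentiable hne x
  have d3 := (contDiff_pdC i hu).differentiable hne x
  have d4 := (contDiff_pdC i hw).differentiable hne x
  have d5 := (contDiffAt_norm_rpow (n := 1) α hx).differentiableAt one_ne_zero
  have d6 := (contDiffAt_norm_rpow (n := 1) (α - 2) hx).differentiableAt one_ne_zero
  have d7 := (contDiff_coord (n := 1) i).differentiable one_ne_zero x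
  have dc (z : ℂ) : DifferentiableAt ℝ (fun _ : EuclideanSpace ℝ (Fin N) => z) x :=
    differentiableAt_const z
  have pc (z : ℂ) : pdC i (fun _ : EuclideanSpace ℝ (Fin N) => z) x = 0 := by simp [pdC]
  unfold adjointFlux
  have d12 := d1.fun_mul d2
  have d712 := d7.fun_mul d12
  have d6712 := d6.fun_mul d712
  have d32 := d3.fun_mul d2
  have d14 := d1.fun_mul d4
  have dr := (dc 1).fun_add d5
  have ds := d32.fun_sub d14
  rw [pdC_add i (dr.fun_mul ds) ((dc _).fun_mul d6712), pdC_mul i dr ds,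
    pdC_add i (dc _) d5, pdC_sub i d32 d14, pdC_mul i d3 d2, pdC_mul i d1 d4,
    pdC_mul i (dc _) d6712, pdC_mul i d6 d712, pdC_mul i d7 d12, pdC_mul i d1 d2,
    pdC_norm_rpow i _ hx, pdC_norm_rpow i _ hx,
    pdC_coord, pc, pc]
  push_cast
  ring

lemma Abc_mul_sub_mul_Abc (α β b c : ℝ) (hu : ContDiff ℝ (⊤ : ℕ∞) u)
    (hw : ContDiff ℝ (⊤ : ℕ∞) w) (h0 : 0 ∉ tsupport u) (x : EuclideanSpace ℝ (Fin N)) :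
    Abc α β b c u x * w x = u x * Abc α β (2 * α - b) (c + (b - α) * (α - 2 + N)) w x
      + ∑ i, pdC i (adjointFlux α b u w i) x := by
  by_cases hx : x = 0
  · subst hx
    have h := notMem_tsupport_iff_eventuallyEq.mp h0
    have hF (i : Fin N) : pdC i (adjointFlux α b u w i) 0 = 0 :=
      (pdC_eventuallyEq_zero i (adjointFlux_eventuallyEq_zero α b i h0)).eq_of_nhds
    have h1 (i : Fin N) : pdC i (pdC i u) 0 = 0 :=
      (pdC_eventuallyEq_zero i (pdC_eventuallyEq_zero i h)).eq_of_nhds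
    have hu0 : u 0 = 0 := h.eq_of_nhds
    simp [Abc, lapC, hF, h1, hu0]
  · have hr : ((‖x‖ ^ (α - 2 - 2) : ℝ) : ℂ) * ∑ i, (x i : ℂ) ^ 2 = ((‖x‖ ^ (α - 2) : ℝ) : ℂ) := by
      have hs : ∑ i, (x i : ℂ) ^ 2 = ((‖x‖ ^ 2 : ℝ) : ℂ) := by
        rw [EuclideanSpace.real_norm_sq_eq]
        push_cast
        rfl
      rw [hs, ← Complex.ofReal_mul, ← Real.rpow_natCast ‖x‖ 2,
        ← Real.rpow_add (norm_pos_iff.mpr hx)]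
      norm_num
    simp only [pdC_adjointFlux α b _ hu hw hx, Finset.sum_add_distrib, ← Finset.mul_sum,
      ← Finset.sum_mul, Finset.sum_sub_distrib, Finset.sum_const, Finset.card_univ,
      Fintype.card_fin, nsmul_eq_mul, Abc, lapC]
    push_cast at hr ⊢
    linear_combination (-(b - α) * (α - 2) * (u x * w x) : ℂ) * hr

end Flux

lemma conj_Abc {N : ℕ} (α β b c : ℝ) (f : EuclideanSpace ℝ (Fin N) → ℂ)
    (x : EuclideanSpace ℝ (Fin N)) :
    (starRingEnd ℂ) (Abc α β b c f x) = Abc α β b c (fun y => (starRingEnd ℂ) (f y)) x := by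
  simp only [Abc, lapC_conj, pdC_conj, map_sub, map_add, map_mul, map_sum, Complex.conj_ofReal]

theorem stmt16 (N : ℕ) (hN : 3 ≤ N) (α β b c : ℝ) (hα0 : 0 ≤ α) (hα2 : α < 2) (hβ : 0 < β)
    (b₁ c₁ : ℝ) (hb₁ : b₁ = 2 * α - b) (hc₁ : c₁ = c + (b - α) * (α - 2 + N))
    (u v : EuclideanSpace ℝ (Fin N) → ℂ) (hu : IsTestAway0 u) (hv : IsTestAway0 v) :
    ∫ x, Abc α β b c u x * (starRingEnd ℂ) (v x) =
      ∫ x, u x * (starRingEnd ℂ) (Abc α β b₁ c₁ v x) := by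
  subst hb₁ hc₁
  obtain ⟨hus, huc, hu0⟩ := hu
  have hw : ContDiff ℝ (⊤ : ℕ∞) (fun y => (starRingEnd ℂ) (v y)) :=
    Complex.conjCLE.contDiff.comp hv.1
  have hF (i : Fin N) := contDiff_adjointFlux α b i hus hw hu0
  have hFc (i : Fin N) := hasCompactSupport_adjointFlux
    (w := fun y => (starRingEnd ℂ) (v y)) α b i huc
  have hint := integrable_finsetSum Finset.univ fun i _ => integrable_pdC i (hF i) (hFc i)
  have hzero : ∫ x, ∑ i, pdC i (adjointFlux α b u (fun y => (starRingEnd ℂ) (v y)) i) x = 0 := by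
    rw [integral_finsetSum _ fun i _ => integrable_pdC i (hF i) (hFc i)]
    exact Finset.sum_eq_zero fun i _ => integral_pdC_eq_zero i (hF i) (hFc i)
  simp only [conj_Abc, Abc_mul_sub_mul_Abc α β b c hus hw hu0]
  -- Subtracting the integrable divergence does not affect integrability.
  by_cases hg : Integrable fun x => u x *
      Abc α β (2 * α - b) (c + (b - α) * (α - 2 + N)) (fun y => (starRingEnd ℂ) (v y)) x
  · rw [integral_add hg hint, hzero, add_zero]
  · rw [integral_undef hg, integral_undef]
    exact fun h => hg ((integrable_add_iff_integrable_left' hint).mp h)
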